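/- Let A ≥ 1 and let (X,d) be an unbounded A-uniform metric space with d(x) > 0 for every x ∈ X, and let k be its quasihyperbolic metric. Then there exists a constant C ≥ 0 depending only on A such that for all points x, y, z, u ∈ X satisfying max(d(x,y), d(x,z)) ≤ (1/2)·d(x,u), 0 < d(x,y) ≤ d(x,z), and d(x) ≤ d(x,y) (where d(x) is the distance from x to ∂X), one has (x|z)^k_u − (x|y)^k_u ≤ log( d(x,y)/d(x,z) ) + C. -/

import Mathlib

open Metric Filter Set

noncomputable section

universe u v

/-- Gromov product of `x` and `y` with respect to base point `w`,
for a real-valued distance kernel `ρ`. -/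
def gromovProd {X : Type u} (ρ : X → X → ℝ) (w x y : X) : ℝ :=
  (ρ x w + ρ y w - ρ x y) / 2

/-- `(X, ρ)` is δ-hyperbolic. -/
def IsDeltaHyp {X : Type u} (ρ : X → X → ℝ) (δ : ℝ) : Prop :=
  ∀ x y z w : X, gromovProd ρ w x y ≥ min (gromovProd ρ w x z) (gromovProd ρ w z y) - δ

/-- `f` is a (λ,μ)-rough similarity. -/
def RoughSimilarity {X : Type u} {Y : Type v} [MetricSpace X] [MetricSpace Y]
    (lam mu : ℝ) (f : X → Y) : Prop :=
  (∀ y : Y, ∃ x : X, dist y (f x) ≤ mu) ∧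
  (∀ x x' : X, lam * dist x x' - mu ≤ dist (f x) (f x') ∧
    dist (f x) (f x') ≤ lam * dist x x' + mu)

/-- The distance from `x ∈ X` to the metric boundary `∂X = X̄ \ X`. -/
def distToBdry (X : Type u) [MetricSpace X] (x : X) : ℝ :=
  Metric.infDist (x : UniformSpace.Completion X)
    (Set.range ((↑) : X → UniformSpace.Completion X))ᶜ

/-- `X` is noncomplete, i.e. `∂X = X̄ \ X ≠ ∅`. -/
def IsNoncomplete (X : Type u) [MetricSpace X] : Prop :=
  ((Set.range ((↑) : X → UniformSpace.Completion X))ᶜ).Nonempty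

/-- Ibragimov's hyperbolization metric. -/
def hMetric (X : Type u) [MetricSpace X] (x y : X) : ℝ :=
  2 * Real.log ((dist x y + max (distToBdry X x) (distToBdry X y)) /
    Real.sqrt (distToBdry X x * distToBdry X y))

/-- The j̃-metric. -/
def jtMetric (X : Type u) [MetricSpace X] (x y : X) : ℝ :=
  (1 / 2) * Real.log ((1 + dist x y / distToBdry X x) * (1 + dist x y / distToBdry X y))

/-- The quasihyperbolic metric. -/
def quasihyperbolic (X : Type u) [MetricSpace X] (x y : X) : ℝ :=
  sInf {r : ℝ | ∃ L : ℝ, 0 ≤ L ∧ ∃ γ : ℝ → X,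
    LipschitzOnWith 1 γ (Set.Icc 0 L) ∧ γ 0 = x ∧ γ L = y ∧
    r = ∫ t in (0:ℝ)..L, (distToBdry X (γ t))⁻¹}

/-- `X` is an `A`-uniform metric space. -/
def IsUniformMS (X : Type u) [MetricSpace X] (A : ℝ) : Prop :=
  ∀ x y : X, ∃ L : ℝ, 0 ≤ L ∧ ∃ γ : ℝ → X,
    LipschitzOnWith 1 γ (Set.Icc 0 L) ∧ γ 0 = x ∧ γ L = y ∧
    L ≤ A * dist x y ∧ ∀ t ∈ Set.Icc (0:ℝ) L, min t (L - t) ≤ A * distToBdry X (γ t)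

/-- `X` is unbounded. -/
def IsUnbounded (X : Type u) [MetricSpace X] : Prop :=
  ¬ Bornology.IsBounded (Set.univ : Set X)

lemma distToBdry_le_add {X : Type u} [MetricSpace X] (x y : X) :
    distToBdry X x ≤ distToBdry X y + dist x y := by
  unfold distToBdry
  rw [← UniformSpace.Completion.dist_eq]
  exact Metric.infDist_le_infDist_add_dist

lemma continuous_distToBdry {X : Type u} [MetricSpace X] : Continuous (distToBdry X) :=
  (Metric.continuous_infDist_pt _).comp (UniformSpace.Completion.continuous_coe X)

/-- The quasihyperbolic length of the arc of `γ` between the parameters `s` and `t`. -/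
def qhLength {X : Type u} [MetricSpace X] (γ : ℝ → X) (s t : ℝ) : ℝ :=
  ∫ τ in s..t, (distToBdry X (γ τ))⁻¹

lemma LipschitzOnWith.dist_le_sub {X : Type u} [MetricSpace X] {γ : ℝ → X} {S : Set ℝ}
    (hγ : LipschitzOnWith 1 γ S) {s t : ℝ} (hs : s ∈ S) (ht : t ∈ S) (hst : s ≤ t) :
    dist (γ s) (γ t) ≤ t - s := by
  have h := hγ.dist_le_mul s hs t ht
  rw [dist_comm s t, Real.dist_eq, abs_of_nonneg (sub_nonneg.2 hst)] at h
  simpa using h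

lemma lipschitzOnWith_one_of_dist_le_sub {X : Type u} [MetricSpace X] {γ : ℝ → X} {S : Set ℝ}
    (h : ∀ s ∈ S, ∀ t ∈ S, s ≤ t → dist (γ s) (γ t) ≤ t - s) : LipschitzOnWith 1 γ S := by
  refine LipschitzOnWith.of_dist_le_mul fun s hs t ht => ?_
  rw [NNReal.coe_one, one_mul, Real.dist_eq]
  rcases le_total s t with hst | hst
  · rw [abs_sub_comm]
    exact (h s hs t ht hst).trans (le_abs_self _)
  · rw [dist_comm]
    exact (h t ht s hs hst).trans (le_abs_self _)

lemma continuousOn_inv_distToBdry {X : Type u} [MetricSpace X]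
    (hpos : ∀ x : X, 0 < distToBdry X x) {γ : ℝ → X} {S : Set ℝ} (hγ : LipschitzOnWith 1 γ S) :
    ContinuousOn (fun τ => (distToBdry X (γ τ))⁻¹) S :=
  (continuous_distToBdry.comp_continuousOn hγ.continuousOn).inv₀ fun τ _ => (hpos (γ τ)).ne'

lemma qhLength_nonneg {X : Type u} [MetricSpace X] (hpos : ∀ x : X, 0 < distToBdry X x)
    (γ : ℝ → X) {s t : ℝ} (hst : s ≤ t) : 0 ≤ qhLength γ s t :=
  intervalIntegral.integral_nonneg hst fun τ _ => (inv_pos.2 (hpos (γ τ))).le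

lemma qhLength_add {X : Type u} [MetricSpace X] (hpos : ∀ x : X, 0 < distToBdry X x)
    {γ : ℝ → X} {r s t : ℝ} (hrs : r ≤ s) (hst : s ≤ t) (hγ : LipschitzOnWith 1 γ (Icc r t)) :
    qhLength γ r s + qhLength γ s t = qhLength γ r t :=
  intervalIntegral.integral_add_adjacent_intervals
    ((continuousOn_inv_distToBdry hpos
      (hγ.mono (Icc_subset_Icc_right hst))).intervalIntegrable_of_Icc hrs)
    ((continuousOn_inv_distToBdry hpos
      (hγ.mono (Icc_subset_Icc_left hrs))).intervalIntegrable_of_Icc hst)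

lemma quasihyperbolic_le_qhLength {X : Type u} [MetricSpace X]
    (hpos : ∀ x : X, 0 < distToBdry X x) {γ : ℝ → X} {s t : ℝ} (hst : s ≤ t)
    (hγ : LipschitzOnWith 1 γ (Icc s t)) :
    quasihyperbolic X (γ s) (γ t) ≤ qhLength γ s t := by
  refine csInf_le ⟨0, ?_⟩ ⟨t - s, sub_nonneg.2 hst, fun τ => γ (s + τ), ?_, by simp, by simp, ?_⟩
  · rintro _ ⟨L, hL, η, -, -, -, rfl⟩
    exact qhLength_nonneg hpos η hL
  · refine lipschitzOnWith_one_of_dist_le_sub fun a ha b hb hab => ?_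
    have := hγ.dist_le_sub (s := s + a) (t := s + b) ⟨by linarith [ha.1], by linarith [ha.2]⟩
      ⟨by linarith [hb.1], by linarith [hb.2]⟩ (by linarith)
    linarith
  · rw [intervalIntegral.integral_comp_add_left (fun τ => (distToBdry X (γ τ))⁻¹) s]
    simp [qhLength]

lemma exists_curve_qhLength_lt {X : Type u} [MetricSpace X] {A : ℝ} (hX : IsUniformMS X A)
    (x y : X) {ε : ℝ} (hε : 0 < ε) :
    ∃ L : ℝ, 0 ≤ L ∧ ∃ γ : ℝ → X, LipschitzOnWith 1 γ (Icc 0 L) ∧ γ 0 = x ∧ γ L = y ∧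
      qhLength γ 0 L < quasihyperbolic X x y + ε := by
  obtain ⟨L, hL, γ, h1, h2, h3, -⟩ := hX x y
  obtain ⟨_, ⟨L', hL', γ', h1', h2', h3', rfl⟩, hlt⟩ :=
    exists_lt_of_csInf_lt (by exact ⟨_, L, hL, γ, h1, h2, h3, rfl⟩)
      (lt_add_of_pos_right (quasihyperbolic X x y) hε)
  exact ⟨L', hL', γ', h1', h2', h3', hlt⟩

lemma quasihyperbolic_comm {X : Type u} [MetricSpace X] (x y : X) :
    quasihyperbolic X x y = quasihyperbolic X y x := by
  unfold quasihyperbolic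
  congr 1
  suffices H : ∀ x y : X, {r : ℝ | ∃ L : ℝ, 0 ≤ L ∧ ∃ γ : ℝ → X,
      LipschitzOnWith 1 γ (Set.Icc 0 L) ∧ γ 0 = x ∧ γ L = y ∧
      r = ∫ t in (0:ℝ)..L, (distToBdry X (γ t))⁻¹} ⊆ {r : ℝ | ∃ L : ℝ, 0 ≤ L ∧ ∃ γ : ℝ → X,
      LipschitzOnWith 1 γ (Set.Icc 0 L) ∧ γ 0 = y ∧ γ L = x ∧
      r = ∫ t in (0:ℝ)..L, (distToBdry X (γ t))⁻¹} from (H x y).antisymm (H y x)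
  rintro x y _ ⟨L, hL, γ, hγ, h0, h1, rfl⟩
  refine ⟨L, hL, fun t => γ (L - t), ?_, by simpa using h1, by simpa using h0, ?_⟩
  · refine lipschitzOnWith_one_of_dist_le_sub fun a ha b hb hab => ?_
    have := hγ.dist_le_sub (s := L - b) (t := L - a) ⟨by linarith [hb.2], by linarith [hb.1]⟩
      ⟨by linarith [ha.2], by linarith [ha.1]⟩ (by linarith)
    rw [dist_comm]
    linarith
  · rw [intervalIntegral.integral_comp_sub_left (fun τ => (distToBdry X (γ τ))⁻¹) L]
    simp

lemma exists_concat {X : Type u} [MetricSpace X] {γ η : ℝ → X} {a b : ℝ} (ha : 0 ≤ a)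
    (hb : 0 ≤ b) (hγ : LipschitzOnWith 1 γ (Icc 0 a)) (hη : LipschitzOnWith 1 η (Icc 0 b))
    (h : γ a = η 0) :
    ∃ ζ : ℝ → X, LipschitzOnWith 1 ζ (Icc 0 (a + b)) ∧ (∀ t ∈ Icc 0 a, ζ t = γ t) ∧
      ∀ t ∈ Icc 0 b, ζ (a + t) = η t := by
  have h1 : ∀ t ≤ a, (if t ≤ a then γ t else η (t - a)) = γ t := fun t ht => if_pos ht
  have h2 : ∀ t : ℝ, a ≤ t → (if t ≤ a then γ t else η (t - a)) = η (t - a) := by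
    intro t ht
    rcases ht.eq_or_lt with rfl | ht
    · simpa using h
    · exact if_neg ht.not_ge
  refine ⟨fun t => if t ≤ a then γ t else η (t - a), ?_, fun t ht => h1 t ht.2, fun t ht => ?_⟩
  · refine lipschitzOnWith_one_of_dist_le_sub fun s hs t ht hst => ?_
    rcases le_total t a with hta | hta
    · rw [h1 t hta, h1 s (hst.trans hta)]
      exact hγ.dist_le_sub ⟨hs.1, hst.trans hta⟩ ⟨ht.1, hta⟩ hst
    rcases le_total a s with has | has
    · rw [h2 t hta, h2 s has]
      have := hη.dist_le_sub (s := s - a) (t := t - a) ⟨by linarith, by linarith [hs.2]⟩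
        ⟨by linarith, by linarith [ht.2]⟩ (by linarith)
      linarith
    · rw [h2 t hta, h1 s has]
      have e1 := hγ.dist_le_sub ⟨hs.1, has⟩ (right_mem_Icc.2 ha) has
      have e2 := hη.dist_le_sub (s := 0) (t := t - a) ⟨le_rfl, hb⟩
        ⟨by linarith, by linarith [ht.2]⟩ (by linarith)
      rw [h] at e1
      linarith [dist_triangle (γ s) (η 0) (η (t - a))]
  · exact (h2 (a + t) (by linarith [ht.1])).trans (by rw [add_sub_cancel_left])

lemma quasihyperbolic_triangle {X : Type u} [MetricSpace X] {A : ℝ} (hX : IsUniformMS X A)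
    (hpos : ∀ x : X, 0 < distToBdry X x) (x y z : X) :
    quasihyperbolic X x z ≤ quasihyperbolic X x y + quasihyperbolic X y z := by
  refine le_of_forall_pos_le_add fun ε hε => ?_
  obtain ⟨a, ha, γ, hγ, γ0, γa, hγl⟩ := exists_curve_qhLength_lt hX x y (half_pos hε)
  obtain ⟨b, hb, η, hη, η0, ηb, hηl⟩ := exists_curve_qhLength_lt hX y z (half_pos hε)
  obtain ⟨ζ, hζ, h1, h2⟩ := exists_concat ha hb hγ hη (γa.trans η0.symm)
  have hle := quasihyperbolic_le_qhLength hpos (add_nonneg ha hb) hζ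
  rw [← qhLength_add hpos ha (le_add_of_nonneg_right hb) hζ, h2 b ⟨hb, le_rfl⟩,
    h1 0 ⟨le_rfl, ha⟩, γ0, ηb] at hle
  have e1 : qhLength ζ 0 a = qhLength γ 0 a := by
    refine intervalIntegral.integral_congr fun t ht => ?_
    rw [uIcc_of_le ha] at ht
    simp only [h1 t ht]
  have e2 : qhLength ζ a (a + b) = qhLength η 0 b := by
    have := intervalIntegral.integral_comp_add_left (a := 0) (b := b)
      (fun τ => (distToBdry X (ζ τ))⁻¹) a
    rw [add_zero] at this
    rw [qhLength, ← this]
    refine intervalIntegral.integral_congr fun t ht => ?_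
    rw [uIcc_of_le hb] at ht
    simp only [h2 t ht]
  linarith

lemma log_distToBdry_div_le_qhLength {X : Type u} [MetricSpace X]
    (hpos : ∀ x : X, 0 < distToBdry X x) {γ : ℝ → X} {s t : ℝ} (hst : s ≤ t)
    (hγ : LipschitzOnWith 1 γ (Icc s t)) :
    Real.log (distToBdry X (γ t) / distToBdry X (γ s)) ≤ qhLength γ s t := by
  have h0 := hpos (γ s)
  have hle : ∀ τ ∈ Icc s t, distToBdry X (γ τ) ≤ (distToBdry X (γ s) - s) + τ := by
    intro τ hτ
    have h1 := distToBdry_le_add (γ τ) (γ s)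
    have h2 := hγ.dist_le_sub (left_mem_Icc.2 hst) hτ hτ.1
    rw [dist_comm] at h1
    linarith
  have hint : ∫ τ in s..t, ((distToBdry X (γ s) - s) + τ)⁻¹ =
      Real.log ((distToBdry X (γ s) - s + t) / distToBdry X (γ s)) := by
    rw [intervalIntegral.integral_comp_add_left (fun τ => τ⁻¹), integral_inv_of_pos (by linarith)
      (by linarith)]
    simp
  calc Real.log (distToBdry X (γ t) / distToBdry X (γ s))
      ≤ Real.log ((distToBdry X (γ s) - s + t) / distToBdry X (γ s)) :=
        Real.log_le_log (div_pos (hpos _) h0)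
          (div_le_div_of_nonneg_right (hle t ⟨hst, le_rfl⟩) h0.le)
    _ = ∫ τ in s..t, ((distToBdry X (γ s) - s) + τ)⁻¹ := hint.symm
    _ ≤ qhLength γ s t := by
        refine intervalIntegral.integral_mono_on hst ?_
          ((continuousOn_inv_distToBdry hpos hγ).intervalIntegrable_of_Icc hst) fun τ hτ =>
          inv_anti₀ (hpos _) (hle τ hτ)
        refine ContinuousOn.intervalIntegrable_of_Icc hst (ContinuousOn.inv₀ (by fun_prop) ?_)
        intro τ hτ
        have := hτ.1
        linarith

/-- Logarithmic upper bound for the quasihyperbolic metric of a uniform space. -/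
lemma quasihyperbolic_le_log {X : Type u} [MetricSpace X] {A : ℝ} (hA : 0 ≤ A)
    (hX : IsUniformMS X A) (hpos : ∀ x : X, 0 < distToBdry X x) {x y : X} {m D : ℝ} (hm : 0 < m)
    (hx : m ≤ distToBdry X x) (hy : m ≤ distToBdry X y) (hD : dist x y ≤ D) :
    quasihyperbolic X x y ≤ 2 * (1 + 2 * A) * Real.log (1 + A * (D / m)) := by
  obtain ⟨L, hL, γ, hγ, rfl, rfl, hLA, hmin⟩ := hX x y
  have hbd : ∀ t ∈ Icc (0 : ℝ) L,
      (distToBdry X (γ t))⁻¹ ≤ (1 + 2 * A) * ((m + t)⁻¹ + (m + L - t)⁻¹) := by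
    intro t ht
    have h1 := distToBdry_le_add (γ 0) (γ t)
    have h2 := hγ.dist_le_sub ⟨le_rfl, hL⟩ ht ht.1
    have h3 := distToBdry_le_add (γ L) (γ t)
    have h4 := hγ.dist_le_sub ht ⟨hL, le_rfl⟩ ht.2
    rw [dist_comm] at h3
    have h5 := hmin t ht
    have hp1 : 0 < m + t := by linarith [ht.1]
    have hp2 : 0 < m + L - t := by linarith [ht.2]
    have key : ∀ w : ℝ, 0 < w → w ≤ (1 + 2 * A) * distToBdry X (γ t) →
        (distToBdry X (γ t))⁻¹ ≤ (1 + 2 * A) * w⁻¹ := by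
      intro w hw h
      rw [← div_eq_mul_inv, inv_eq_one_div, div_le_div_iff₀ (hpos _) hw, one_mul]
      exact h
    rcases min_le_iff.1 h5 with h | h
    · have := key (m + t) hp1 (by linarith)
      have := mul_nonneg (by linarith : 0 ≤ 1 + 2 * A) (inv_pos.2 hp2).le
      linarith
    · have := key (m + L - t) hp2 (by linarith)
      have := mul_nonneg (by linarith : 0 ≤ 1 + 2 * A) (inv_pos.2 hp1).le
      linarith
  have hi1 : IntervalIntegrable (fun t => (m + t)⁻¹) MeasureTheory.volume 0 L := by
    refine ContinuousOn.intervalIntegrable_of_Icc hL (ContinuousOn.inv₀ (by fun_prop) ?_)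
    intro t ht
    linarith [ht.1]
  have hi2 : IntervalIntegrable (fun t => (m + L - t)⁻¹) MeasureTheory.volume 0 L := by
    refine ContinuousOn.intervalIntegrable_of_Icc hL (ContinuousOn.inv₀ (by fun_prop) ?_)
    intro t ht
    linarith [ht.2]
  have e1 : ∫ t in (0 : ℝ)..L, (m + t)⁻¹ = Real.log ((m + L) / m) := by
    rw [intervalIntegral.integral_comp_add_left (fun τ => τ⁻¹), integral_inv_of_pos (by linarith)
      (by linarith)]
    simp
  have e2 : ∫ t in (0 : ℝ)..L, (m + L - t)⁻¹ = Real.log ((m + L) / m) := by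
    rw [intervalIntegral.integral_comp_sub_left (fun τ => τ⁻¹), integral_inv_of_pos (by linarith)
      (by linarith)]
    simp
  have hlog : Real.log ((m + L) / m) ≤ Real.log (1 + A * (D / m)) := by
    refine Real.log_le_log (by positivity) ?_
    rw [add_div, div_self hm.ne', ← mul_div_assoc]
    gcongr
    exact hLA.trans (mul_le_mul_of_nonneg_left hD hA)
  calc quasihyperbolic X (γ 0) (γ L) ≤ qhLength γ 0 L := quasihyperbolic_le_qhLength hpos hL hγ
    _ ≤ ∫ t in (0 : ℝ)..L, (1 + 2 * A) * ((m + t)⁻¹ + (m + L - t)⁻¹) :=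
        intervalIntegral.integral_mono_on hL
          ((continuousOn_inv_distToBdry hpos hγ).intervalIntegrable_of_Icc hL)
          ((hi1.add hi2).const_mul _) hbd
    _ = (1 + 2 * A) * (2 * Real.log ((m + L) / m)) := by
        rw [intervalIntegral.integral_const_mul, intervalIntegral.integral_add hi1 hi2, e1, e2]
        ring
    _ ≤ 2 * (1 + 2 * A) * Real.log (1 + A * (D / m)) := by
        nlinarith

lemma exists_first_hit {f : ℝ → ℝ} {a b c : ℝ} (hab : a ≤ b) (hf : ContinuousOn f (Icc a b))
    (ha : f a ≤ c) (hb : c ≤ f b) :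
    ∃ s ∈ Icc a b, f s = c ∧ ∀ τ ∈ Icc a s, f τ ≤ c := by
  have hne : (Icc a b ∩ f ⁻¹' {c}).Nonempty := by
    obtain ⟨t, ht, hft⟩ := intermediate_value_Icc hab hf ⟨ha, hb⟩
    exact ⟨t, ht, hft⟩
  have hcpt : IsCompact (Icc a b ∩ f ⁻¹' {c}) :=
    isCompact_Icc.of_isClosed_subset
      (hf.preimage_isClosed_of_isClosed isClosed_Icc isClosed_singleton) inter_subset_left
  obtain ⟨s, ⟨hs, hfs⟩, hmin⟩ := hcpt.exists_isLeast hne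
  refine ⟨s, hs, hfs, fun τ hτ => ?_⟩
  by_contra! hlt
  obtain ⟨t, ht, hft⟩ := intermediate_value_Icc hτ.1
    (hf.mono (Icc_subset_Icc_right (hτ.2.trans hs.2))) ⟨ha, hlt.le⟩
  have hst : s ≤ t := hmin ⟨⟨ht.1, ht.2.trans (hτ.2.trans hs.2)⟩, hft⟩
  obtain rfl : τ = s := le_antisymm hτ.2 (hst.trans ht.2)
  exact hlt.ne' hfs

/-- A function which varies on scale `K * m` between times of size comparable to `m` needs at most
time `K * M` to grow to its maximal value `M`. -/
lemma sub_le_of_dyadic {φ : ℝ → ℝ} {K a b : ℝ} (hφ : ContinuousOn φ (Icc a b))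
    (hpos : ∀ t, 0 < φ t)
    (H : ∀ s ∈ Icc a b, ∀ t ∈ Icc a b, s ≤ t → ∀ m > 0, m ≤ φ s → m ≤ φ t →
      (∀ τ ∈ Icc s t, φ τ ≤ 2 * m) → t - s ≤ K * m) {t : ℝ} (ht : t ∈ Icc a b)
    (hmax : ∀ τ ∈ Icc a t, φ τ ≤ φ t) : t - a ≤ 2 * (K * (φ t / 2)) := by
  have hind : ∀ n : ℕ, ∀ M, ∀ t ∈ Icc a b, (∀ τ ∈ Icc a t, φ τ ≤ M) → M / 2 ≤ φ t →
      M ≤ 2 ^ n * φ a → t - a ≤ 2 * (K * (M / 2)) := by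
    have hK : 0 ≤ K := by
      have := H t ht t ht le_rfl (φ t) (hpos t) le_rfl le_rfl fun τ hτ => by
        obtain rfl : t = τ := le_antisymm hτ.1 hτ.2
        linarith [hpos t]
      rw [sub_self] at this
      exact nonneg_of_mul_nonneg_left this (hpos t)
    intro n
    induction n with
    | zero =>
      intro M t ht hM hMt hMa
      have hM0 : 0 < M := (hpos a).trans_le (hM a ⟨le_rfl, ht.1⟩)
      have := H a ⟨le_rfl, ht.1.trans ht.2⟩ t ht ht.1 (M / 2) (by linarith) (by linarith) hMt
        fun τ hτ => by linarith [hM τ hτ]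
      nlinarith
    | succ n ih =>
      intro M t ht hM hMt hMa
      have hM0 : 0 < M := (hpos a).trans_le (hM a ⟨le_rfl, ht.1⟩)
      have h0 : 0 ≤ K * (M / 2) := by positivity
      rcases le_total (M / 2) (φ a) with h | h
      · have := H a ⟨le_rfl, ht.1.trans ht.2⟩ t ht ht.1 (M / 2) (by linarith) h hMt
          fun τ hτ => by linarith [hM τ hτ]
        linarith
      · obtain ⟨s, hs, hφs, hmax⟩ :=
          exists_first_hit ht.1 (hφ.mono (Icc_subset_Icc_right ht.2)) h hMt
        have hs' : s ∈ Icc a b := ⟨hs.1, hs.2.trans ht.2⟩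
        have h1 := ih (M / 2) s hs' hmax (by linarith) (by rw [pow_succ] at hMa; linarith)
        have h2 := H s hs' t ht hs.2 (M / 2) (by linarith) hφs.ge hMt
          fun τ hτ => by linarith [hM τ ⟨hs.1.trans hτ.1, hτ.2⟩]
        linarith
  obtain ⟨n, hn⟩ := pow_unbounded_of_one_lt (φ t / φ a) one_lt_two
  rw [div_lt_iff₀ (hpos a)] at hn
  exact hind n (φ t) t ht hmax (by linarith [hpos t]) hn.le

lemma exists_mem_sub_le {φ : ℝ → ℝ} {K a b : ℝ} (hab : a ≤ b) (hφ : ContinuousOn φ (Icc a b))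
    (hpos : ∀ t, 0 < φ t)
    (H : ∀ s ∈ Icc a b, ∀ t ∈ Icc a b, s ≤ t → ∀ m > 0, m ≤ φ s → m ≤ φ t →
      (∀ τ ∈ Icc s t, φ τ ≤ 2 * m) → t - s ≤ K * m) :
    ∃ τ ∈ Icc a b, b - a ≤ 2 * K * φ τ := by
  obtain ⟨τ, hτ, hmax⟩ := isCompact_Icc.exists_isMaxOn (nonempty_Icc.2 hab) hφ
  refine ⟨τ, hτ, ?_⟩
  have h1 := sub_le_of_dyadic hφ hpos H hτ fun σ hσ => hmax ⟨hσ.1, hσ.2.trans hτ.2⟩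
  have hneg : ∀ {s : ℝ}, s ∈ Icc (-b) (-a) → -s ∈ Icc a b := fun hs =>
    ⟨by linarith [hs.2], by linarith [hs.1]⟩
  have h2 := sub_le_of_dyadic (φ := fun t => φ (-t)) (K := K) (a := -b) (b := -a) (t := -τ)
    (hφ.comp continuousOn_neg fun s hs => hneg hs) (fun t => hpos _)
    (fun s hs t ht hst m hm h1 h2 h3 => by
      have := H (-t) (hneg ht) (-s) (hneg hs) (by linarith) m hm h2 h1 fun σ hσ => by
        have := h3 (-σ) ⟨by linarith [hσ.2], by linarith [hσ.1]⟩
        simpa using this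
      linarith)
    ⟨by linarith [hτ.2], by linarith [hτ.1]⟩
    (fun σ hσ => by
      rw [neg_neg]
      exact hmax ⟨by linarith [hσ.2, hτ.1], by linarith [hσ.1]⟩)
  rw [neg_neg] at h2
  linarith

lemma exists_bound_of_half_le_log {A B : ℝ} (hA : 1 ≤ A) (hB : 1 ≤ B) :
    ∃ K : ℝ, 1 ≤ K ∧ ∀ x : ℝ, 0 ≤ x → x / 2 ≤ B * Real.log (1 + A * x) + 1 → x ≤ K := by
  have hAB : 1 ≤ A * B := one_le_mul_of_one_le_of_one_le hA hB
  have hlog : 0 ≤ Real.log (4 * (A * B)) := Real.log_nonneg (by linarith)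
  refine ⟨5 + 4 * (B * Real.log (4 * (A * B))), by nlinarith, fun x hx h => ?_⟩
  have hx1 : 0 < 1 + A * x := by positivity
  have h1 := Real.log_le_sub_one_of_pos (div_pos hx1 (by linarith : 0 < 4 * (A * B)))
  rw [Real.log_div hx1.ne' (by linarith)] at h1
  have h2 : B * ((1 + A * x) / (4 * (A * B))) ≤ 1 / 4 + x / 4 := by
    have : B * ((1 + A * x) / (4 * (A * B))) = 1 / (4 * A) + x / 4 := by
      field_simp
    rw [this]
    gcongr
    linarith
  nlinarith

lemma qhLength_le_of_near_geodesic {X : Type u} [MetricSpace X] {A : ℝ} (hX : IsUniformMS X A)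
    (hpos : ∀ x : X, 0 < distToBdry X x) {γ : ℝ → X} {L ε s t : ℝ}
    (hγ : LipschitzOnWith 1 γ (Icc 0 L))
    (hgeo : qhLength γ 0 L ≤ quasihyperbolic X (γ 0) (γ L) + ε) (hs : 0 ≤ s) (hst : s ≤ t)
    (ht : t ≤ L) : qhLength γ s t ≤ quasihyperbolic X (γ s) (γ t) + ε := by
  have h1 := quasihyperbolic_le_qhLength hpos hs
    (hγ.mono (Icc_subset_Icc_right (hst.trans ht)))
  have h2 := quasihyperbolic_le_qhLength hpos ht (hγ.mono (Icc_subset_Icc_left (hs.trans hst)))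
  have h3 := quasihyperbolic_triangle hX hpos (γ 0) (γ s) (γ L)
  have h4 := quasihyperbolic_triangle hX hpos (γ s) (γ t) (γ L)
  have h5 := qhLength_add hpos hs (hst.trans ht) hγ
  have h6 := qhLength_add hpos hst ht (hγ.mono (Icc_subset_Icc_left hs))
  linarith

/-- An almost minimizing curve in a uniform space passes through points which are far from the
boundary on the scale of its length. -/
lemma exists_sub_le_distToBdry {X : Type u} [MetricSpace X] {A K : ℝ} (hA : 0 ≤ A)
    (hK : ∀ x : ℝ, 0 ≤ x → x / 2 ≤ 2 * (1 + 2 * A) * Real.log (1 + A * x) + 1 → x ≤ K)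
    (hX : IsUniformMS X A) (hpos : ∀ x : X, 0 < distToBdry X x) {γ : ℝ → X} {L a b : ℝ}
    (hγ : LipschitzOnWith 1 γ (Icc 0 L))
    (hgeo : qhLength γ 0 L ≤ quasihyperbolic X (γ 0) (γ L) + 1) (ha : 0 ≤ a) (hab : a ≤ b)
    (hb : b ≤ L) : ∃ τ ∈ Icc a b, b - a ≤ 2 * K * distToBdry X (γ τ) := by
  refine exists_mem_sub_le (φ := fun τ => distToBdry X (γ τ)) hab
    (continuous_distToBdry.comp_continuousOn (hγ.mono (Icc_subset_Icc ha hb)).continuousOn)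
    (fun t => hpos _) fun s hs t ht hst m hm hms hmt hle => ?_
  have hs0 := ha.trans hs.1
  have htL := ht.2.trans hb
  have hγ' : LipschitzOnWith 1 γ (Icc s t) := hγ.mono (Icc_subset_Icc hs0 htL)
  have h1 := qhLength_le_of_near_geodesic hX hpos hγ hgeo hs0 hst htL
  have h2 := quasihyperbolic_le_log hA hX hpos hm hms hmt
    (hγ'.dist_le_sub (left_mem_Icc.2 hst) (right_mem_Icc.2 hst) hst)
  have h3 : (t - s) / m / 2 ≤ qhLength γ s t := by
    have : ∫ _ in s..t, (2 * m)⁻¹ ≤ qhLength γ s t :=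
      intervalIntegral.integral_mono_on hst intervalIntegrable_const
        ((continuousOn_inv_distToBdry hpos hγ').intervalIntegrable_of_Icc hst)
        fun τ hτ => inv_anti₀ (hpos _) (hle τ hτ)
    rw [intervalIntegral.integral_const, smul_eq_mul] at this
    refine le_of_eq_of_le ?_ this
    field_simp
  rw [← div_le_iff₀ hm]
  exact hK _ (div_nonneg (sub_nonneg.2 hst) hm.le) (by linarith)

/-- The quasihyperbolic distance from a point close to `x` to a point far from `x` is almost
attained through two points lying at scales `r` and `R` from `x` and far from the boundary. -/
lemma exists_two_waypoints {X : Type u} [MetricSpace X] {A K : ℝ} (hA : 0 ≤ A) (hK1 : 1 ≤ K)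
    (hK : ∀ x : ℝ, 0 ≤ x → x / 2 ≤ 2 * (1 + 2 * A) * Real.log (1 + A * x) + 1 → x ≤ K)
    (hX : IsUniformMS X A) (hpos : ∀ x : X, 0 < distToBdry X x) {x a b : X} {c r R : ℝ}
    (hc1 : 1 ≤ c) (hc2 : c ≤ 2) (hr : 0 < r) (hrR : r ≤ R) (ha : dist x a ≤ (c - 1) * r)
    (hb : c * R ≤ dist x b) :
    ∃ p q : X, dist x p ≤ 2 * r ∧ dist x q ≤ 2 * R ∧ r ≤ 4 * K * distToBdry X p ∧
      R ≤ 4 * K * distToBdry X q ∧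
      quasihyperbolic X a p + Real.log (distToBdry X q / distToBdry X p) +
        quasihyperbolic X q b ≤ quasihyperbolic X a b + 1 := by
  obtain ⟨L, hL, γ, hγ, rfl, rfl, hgeo⟩ := exists_curve_qhLength_lt hX a b one_pos
  have hcrR : c * r ≤ c * R := by gcongr
  have hcont : ContinuousOn (fun t => dist x (γ t)) (Icc 0 L) :=
    (continuous_const.dist continuous_id).comp_continuousOn hγ.continuousOn
  obtain ⟨e, he, hxe, hle_e⟩ := exists_first_hit (c := c * r) hL hcont (by linarith) (by linarith)
  obtain ⟨f, hf, hxf, hle_f⟩ := exists_first_hit (c := c * R) he.2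
    (hcont.mono (Icc_subset_Icc_left he.1)) (by linarith) hb
  obtain ⟨s, hs, hsd⟩ := exists_sub_le_distToBdry hA hK hX hpos hγ hgeo.le le_rfl he.1 he.2
  have hsr : r ≤ 2 * K * distToBdry X (γ s) := by
    have := hγ.dist_le_sub (left_mem_Icc.2 hL) he he.1
    have := dist_triangle x (γ 0) (γ e)
    linarith
  have hdist_s : dist x (γ s) ≤ c * r := hle_e s hs
  have hs_pos : 0 < K * distToBdry X (γ s) := mul_pos (by linarith) (hpos _)
  have hcr : c * r ≤ 2 * r := by gcongr
  have hcR : c * R ≤ 2 * R := mul_le_mul_of_nonneg_right hc2 (hr.le.trans hrR)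
  obtain ⟨t, hst, htL, hdist_t, htR⟩ : ∃ t, s ≤ t ∧ t ≤ L ∧ dist x (γ t) ≤ c * R ∧
      R ≤ 4 * K * distToBdry X (γ t) := by
    rcases le_total R (2 * r) with h | h
    · exact ⟨s, le_rfl, hs.2.trans he.2, hdist_s.trans hcrR, by linarith⟩
    · obtain ⟨t, ht, htd⟩ := exists_sub_le_distToBdry hA hK hX hpos hγ hgeo.le he.1 hf.1 hf.2
      refine ⟨t, hs.2.trans ht.1, ht.2.trans hf.2, hle_f t ht, ?_⟩
      have h1 := hγ.dist_le_sub he ⟨he.1.trans hf.1, hf.2⟩ hf.1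
      have h2 := dist_triangle x (γ e) (γ f)
      nlinarith
  refine ⟨γ s, γ t, hdist_s.trans hcr, hdist_t.trans hcR, by linarith, htR, ?_⟩
  have h1 := quasihyperbolic_le_qhLength hpos hs.1
    (hγ.mono (Icc_subset_Icc_right (hst.trans htL)))
  have h2 := quasihyperbolic_le_qhLength hpos htL
    (hγ.mono (Icc_subset_Icc_left (hs.1.trans hst)))
  have h3 := log_distToBdry_div_le_qhLength hpos hst (hγ.mono (Icc_subset_Icc hs.1 htL))
  have h4 := qhLength_add hpos hs.1 (hst.trans htL) hγ
  have h5 := qhLength_add hpos hst htL (hγ.mono (Icc_subset_Icc_left hs.1))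
  linarith

/-- Gromov product difference estimate, case t < 1. -/
theorem gromovProd_difference_estimate_case_two (A : ℝ) (hA : 1 ≤ A) :
    ∃ C : ℝ, 0 ≤ C ∧
      ∀ (X : Type u) [MetricSpace X], IsUnbounded X → IsUniformMS X A →
        (∀ x : X, 0 < distToBdry X x) →
        ∀ x y z u : X,
          max (dist x y) (dist x z) ≤ (1 / 2) * dist x u →
          0 < dist x y → dist x y ≤ dist x z → distToBdry X x ≤ dist x y →
          gromovProd (quasihyperbolic X) u x z -
              gromovProd (quasihyperbolic X) u x y ≤
            Real.log (dist x y / dist x z) + C := by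
  obtain ⟨K, hK1, hK⟩ :=
    exists_bound_of_half_le_log hA (by linarith : 1 ≤ 2 * (1 + 2 * A))
  have hA0 : 0 ≤ A := zero_le_one.trans hA
  have hK0 : 0 < K := by linarith
  set C₁ := 2 * (1 + 2 * A) * Real.log (1 + A * (16 * K)) with hC₁
  have hC₁0 : 0 ≤ C₁ := mul_nonneg (by linarith) (Real.log_nonneg (by
    have : 0 ≤ A * (16 * K) := by positivity
    linarith))
  have hlogK : 0 ≤ Real.log (12 * K) := Real.log_nonneg (by linarith)
  refine ⟨C₁ + Real.log (12 * K) + 1, by linarith, fun X _ _ hX hpos x y z u hxu hr hrR hdx => ?_⟩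
  obtain ⟨hyu, hzu⟩ := max_le_iff.1 hxu
  have hR : 0 < dist x z := hr.trans_le hrR
  obtain ⟨p, q, hp, hq, hpd, hqd, hpq⟩ := exists_two_waypoints hA0 hK1 hK hX hpos (x := x)
    (a := x) (b := z) (c := 1) le_rfl one_le_two hr hrR (by simp) (by simp)
  obtain ⟨p', q', hp', hq', hpd', hqd', hpq'⟩ := exists_two_waypoints hA0 hK1 hK hX hpos (x := x)
    (a := y) (b := u) (c := 2) one_le_two le_rfl hr hrR (by linarith) (by linarith)
  have hclose : ∀ {ρ : ℝ} {v w : X}, 0 < ρ → dist x v ≤ 2 * ρ → dist x w ≤ 2 * ρ →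
      ρ ≤ 4 * K * distToBdry X v → ρ ≤ 4 * K * distToBdry X w →
      quasihyperbolic X v w ≤ C₁ := by
    intro ρ v w hρ hv hw hvd hwd
    have h := quasihyperbolic_le_log hA0 hX hpos (x := v) (y := w) (m := ρ / (4 * K))
      (D := 4 * ρ) (by positivity) (by rwa [div_le_iff₀' (by positivity)])
      (by rwa [div_le_iff₀' (by positivity)])
      (by linarith [dist_triangle v x w, dist_comm v x])
    have e : 4 * ρ / (ρ / (4 * K)) = 16 * K := by
      field_simp
      norm_num
    rwa [e] at h
  have hlog : ∀ {v w : X}, dist x v ≤ 2 * dist x y → dist x z ≤ 4 * K * distToBdry X w →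
      -Real.log (dist x y / dist x z) - Real.log (12 * K) ≤
        Real.log (distToBdry X w / distToBdry X v) := by
    intro v w hv hw
    have hvd : distToBdry X v ≤ 3 * dist x y := by
      linarith [distToBdry_le_add v x, dist_comm v x]
    rw [← Real.log_inv, inv_div, ← Real.log_div (div_pos hR hr).ne' (by positivity)]
    refine Real.log_le_log (by positivity) ?_
    rw [div_div, div_le_div_iff₀ (by positivity) (hpos v)]
    calc dist x z * distToBdry X v ≤ (4 * K * distToBdry X w) * (3 * dist x y) :=
          mul_le_mul hw hvd (hpos v).le (hR.le.trans hw)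
      _ = distToBdry X w * (dist x y * (12 * K)) := by ring
  have h1 := hclose hr hp hp' hpd hpd'
  have h2 := hclose hR hq hq' hqd hqd'
  have h3 := hlog hp hqd
  have h4 := hlog hp' hqd'
  have h5 := quasihyperbolic_triangle hX hpos x p y
  have h6 := quasihyperbolic_triangle hX hpos p p' y
  have h7 := quasihyperbolic_triangle hX hpos z q u
  have h8 := quasihyperbolic_triangle hX hpos q q' u
  rw [quasihyperbolic_comm p' y] at h6
  rw [quasihyperbolic_comm z q] at h7
  unfold gromovProd
  linarith

end
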